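/- Let x_1, …, x_N ∈ ℝ^d with N ≥ 1, β > 0, and M := max_{1≤i≤N} ‖x_i‖. Define the Hopfield energy E : ℝ^d → ℝ by E(ξ) = −β⁻¹·log(∑_{i=1}^N exp(β·⟨x_i, ξ⟩)) + ½·⟨ξ, ξ⟩ + β⁻¹·log N + ½·M². Then for every ξ ∈ ℝ^d, E(ξ) ≥ ½·(‖ξ‖ − M)², and in particular E(ξ) ≥ 0; that is, the energy is bounded below by zero. -/

import Mathlib

open scoped RealInnerProductSpace

/-- The modern Hopfield energy
`E(ξ) = −β⁻¹·log(∑ᵢ exp(β·⟨xᵢ, ξ⟩)) + ½·⟨ξ, ξ⟩ + β⁻¹·log N + ½·M²`,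
with `M = maxᵢ ‖xᵢ‖`, satisfies `E(ξ) ≥ ½·(‖ξ‖ − M)² ≥ 0` for every `ξ`. -/
theorem hopfield_energy_bounded_below
    (N d : ℕ) (hN : 1 ≤ N) (β : ℝ) (hβ : 0 < β)
    (x : Fin N → EuclideanSpace ℝ (Fin d))
    (M : ℝ) (hM : IsGreatest (Set.range fun i => ‖x i‖) M)
    (E : EuclideanSpace ℝ (Fin d) → ℝ)
    (hE : E = fun ξ =>
      -(β⁻¹ * Real.log (∑ i, Real.exp (β * ⟪x i, ξ⟫)))
        + (1 / 2) * ⟪ξ, ξ⟫ + β⁻¹ * Real.log N + (1 / 2) * M ^ 2) :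
    ∀ ξ : EuclideanSpace ℝ (Fin d),
      (1 / 2) * (‖ξ‖ - M) ^ 2 ≤ E ξ ∧ 0 ≤ E ξ := by
  intro ξ
  have hN0 : (0 : ℝ) < N := by exact_mod_cast hN
  have hsum : ∑ i, Real.exp (β * ⟪x i, ξ⟫) ≤ N * Real.exp (β * (M * ‖ξ‖)) := by
    calc ∑ i, Real.exp (β * ⟪x i, ξ⟫) ≤ ∑ _i : Fin N, Real.exp (β * (M * ‖ξ‖)) := by
          refine Finset.sum_le_sum fun i _ => Real.exp_le_exp.mpr ?_
          refine mul_le_mul_of_nonneg_left ?_ hβ.le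
          exact (real_inner_le_norm _ _).trans
            (mul_le_mul_of_nonneg_right (hM.2 ⟨i, rfl⟩) (norm_nonneg _))
      _ = N * Real.exp (β * (M * ‖ξ‖)) := by simp
  have hpos : 0 < ∑ i, Real.exp (β * ⟪x i, ξ⟫) :=
    Finset.sum_pos (fun i _ => Real.exp_pos _) ⟨⟨0, hN⟩, Finset.mem_univ _⟩
  have hlog := Real.log_le_log hpos hsum
  rw [Real.log_mul hN0.ne' (Real.exp_pos _).ne', Real.log_exp] at hlog
  have h := mul_le_mul_of_nonneg_left hlog (inv_pos.mpr hβ).le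
  rw [mul_add, inv_mul_cancel_left₀ hβ.ne'] at h
  have key : (1 / 2) * (‖ξ‖ - M) ^ 2 ≤ E ξ := by
    rw [hE]
    simp only [real_inner_self_eq_norm_sq]
    nlinarith
  exact ⟨key, le_trans (by positivity) key⟩
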